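/- If k is an even positive integer and l is an odd positive integer with k > l, then u(−t, θ+π) = u(t, θ) for all (t,θ) ∈ ℝ². Hence the Fraser–Sargent surface is invariant under the orientation-reversing involution (t,θ) ↦ (−t, θ+π), and topologically it is a Möbius band. -/

import Mathlib

open Real RealInnerProductSpace

/-- `ρ(t) = (k·l/r)·√(sinh²(l·t) + cosh²(k·t))`. -/
noncomputable def fsRho (k l r t : ℝ) : ℝ :=
  k * l / r * Real.sqrt (Real.sinh (l * t) ^ 2 + Real.cosh (k * t) ^ 2)

/-- The Fraser–Sargent parametrization `u : ℝ² → ℝ⁴`. -/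
noncomputable def fsU (k l r : ℝ) (t θ : ℝ) : EuclideanSpace ℝ (Fin 4) :=
  (1 / r) • (EuclideanSpace.equiv (Fin 4) ℝ).symm
    ![k * Real.sinh (l * t) * Real.cos (l * θ),
      k * Real.sinh (l * t) * Real.sin (l * θ),
      l * Real.cosh (k * t) * Real.cos (k * θ),
      l * Real.cosh (k * t) * Real.sin (k * θ)]

theorem cos_natCast_mul_add_pi (n : ℕ) (θ : ℝ) :
    Real.cos (n * (θ + Real.pi)) = (-1) ^ n * Real.cos (n * θ) := by
  rw [mul_add, Real.cos_add_nat_mul_pi]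

theorem sin_natCast_mul_add_pi (n : ℕ) (θ : ℝ) :
    Real.sin (n * (θ + Real.pi)) = (-1) ^ n * Real.sin (n * θ) := by
  rw [mul_add, Real.sin_add_nat_mul_pi]

/-- If `k` is an even positive integer and `l` an odd positive integer with `k > l`,
then `u(−t, θ+π) = u(t, θ)` for all `(t,θ)`: the Fraser–Sargent surface is invariant
under the orientation-reversing involution `(t,θ) ↦ (−t, θ+π)`, hence topologically
a Möbius band. -/
theorem stmt_6 (k l : ℕ) (hk : Even k) (hl : Odd l) (hk0 : 0 < k) (hl0 : 0 < l)
    (hkl : l < k) (T r : ℝ) (hT : 0 < T)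
    (hTeq : (k : ℝ) * Real.tanh (k * T) = l * (Real.cosh (l * T) / Real.sinh (l * T)))
    (hr : r = Real.sqrt ((k : ℝ) ^ 2 * Real.sinh (l * T) ^ 2 +
      (l : ℝ) ^ 2 * Real.cosh (k * T) ^ 2)) :
    ∀ t θ : ℝ, fsU k l r (-t) (θ + Real.pi) = fsU k l r t θ := by
  intro t θ
  simp only [fsU, cos_natCast_mul_add_pi, sin_natCast_mul_add_pi, hk.neg_one_pow,
    hl.neg_one_pow, mul_neg, Real.sinh_neg, Real.cosh_neg, one_mul, neg_mul, neg_neg]
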